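/- (Zero count near a point is o(λ).) Let q : ℂ → ℂ be a nonzero polynomial, z₀ ∈ ℂ and δ > 0. Then there exists a constant C > 0 such that for every real λ ≥ 1 with λ^{−7/12} ≤ δ/2 and every holomorphic function y on the open disc B(z₀, δ), not identically zero, satisfying y''(z) = λ² q(z) y(z) for all z ∈ B(z₀, δ), the set {z : |z − z₀| ≤ λ^{−7/12}, y(z) = 0} is finite and has at most C λ^{5/6} elements. In particular, (# of zeros of y in the disc of radius λ^{−7/12} about z₀)/λ → 0 as λ → ∞. -/

import Mathlib

open MeasureTheory Filter Topology

/-- Zero spacing: two distinct zeros of a nontrivial solution are not too close. -/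
lemma zero_spacing (U : Set ℂ) (hU : IsOpen U) (hc : Convex ℝ U) (y : ℂ → ℂ)
    (hy : DifferentiableOn ℂ y U) (hne : ∃ z ∈ U, y z ≠ 0) (B : ℝ) (hB : 0 ≤ B)
    (hyy : ∀ z ∈ U, ‖deriv (deriv y) z‖ ≤ B * ‖y z‖)
    (a b : ℂ) (ha : a ∈ U) (hb : b ∈ U) (hab : a ≠ b) (ya : y a = 0) (yb : y b = 0) :
    1 ≤ 2 * B * ‖b - a‖ ^ 2 := by
  set S := segment ℝ a b with hS
  have hSU : S ⊆ U := hc.segment_subset ha hb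
  have aS : a ∈ S := left_mem_segment ℝ a b
  have bS : b ∈ S := right_mem_segment ℝ a b
  have hScomp : IsCompact S := by
    rw [hS, segment_eq_image_lineMap]
    exact isCompact_Icc.image (by fun_prop)
  have hSc : Convex ℝ S := convex_segment a b
  have hle : ∀ z ∈ S, ‖z - a‖ ≤ ‖b - a‖ := by
    intro z hz
    rw [hS, segment_eq_image_lineMap] at hz
    obtain ⟨t, ⟨h0, h1⟩, rfl⟩ := hz
    simp only [AffineMap.lineMap_apply, vsub_eq_sub, vadd_eq_add, add_sub_cancel_right, norm_smul,
      Real.norm_eq_abs, abs_of_nonneg h0]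
    nlinarith [norm_nonneg (b - a)]
  have hy' : DifferentiableOn ℂ (deriv y) U := hy.deriv hU
  obtain ⟨w, hwS, hw⟩ := hScomp.exists_isMaxOn ⟨a, aS⟩ ((hy.mono hSU).continuousOn.norm)
  have hmax : ∀ z ∈ S, ‖y z‖ ≤ ‖y w‖ := fun z hz => hw hz
  set m := ‖y w‖ with hm
  have hL0 : 0 < ‖b - a‖ := norm_pos_iff.2 (sub_ne_zero.2 hab.symm)
  have hmpos : 0 < m := by
    by_contra hcon
    have hz : ∀ z ∈ S, y z = 0 := fun z hz => norm_le_zero_iff.1 ((hmax z hz).trans (not_lt.1 hcon))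
    have han : AnalyticOnNhd ℂ y U := hy.analyticOnNhd hU
    have hacc : AccPt a (𝓟 S) :=
      hSc.isPreconnected.preperfect_of_nontrivial ⟨a, aS, b, bS, hab⟩ a aS
    have hfr : ∃ᶠ z in 𝓝[≠] a, y z = 0 :=
      (accPt_iff_frequently_nhdsNE.1 hacc).mono hz
    obtain ⟨z, hzU, hz0⟩ := hne
    exact hz0 (han.eqOn_zero_of_preconnected_of_frequently_eq_zero hc.isPreconnected ha hfr hzU)
  set L := ‖b - a‖ with hL
  have h1 : ∀ z ∈ S, ‖deriv y z - deriv y a‖ ≤ B * m * L := by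
    intro z hz
    have := hSc.norm_image_sub_le_of_norm_hasDerivWithin_le (f := deriv y) (f' := deriv (deriv y))
      (C := B * m) (fun x hx => ((hy'.differentiableAt
        (hU.mem_nhds (hSU hx))).hasDerivAt.hasDerivWithinAt))
      (fun x hx => (hyy x (hSU hx)).trans (mul_le_mul_of_nonneg_left (hmax x hx) hB)) aS hz
    exact this.trans (mul_le_mul_of_nonneg_left (hle z hz) (by positivity))
  have h2 : ∀ z ∈ S, ‖y z - deriv y a * (z - a)‖ ≤ B * m * L * L := by
    intro z hz
    have := hSc.norm_image_sub_le_of_norm_hasDerivWithin_le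
      (f := fun z => y z - deriv y a * (z - a)) (f' := fun z => deriv y z - deriv y a)
      (C := B * m * L) (fun x hx => by
        have e1 := (hy.differentiableAt (hU.mem_nhds (hSU hx))).hasDerivAt
        have e2 := (((hasDerivAt_id x).sub_const a).const_mul (deriv y a))
        have := e1.sub e2
        rw [mul_one] at this
        exact this.hasDerivWithinAt)
      h1 aS hz
    simp only [sub_self, mul_zero, ya, sub_zero] at this
    exact this.trans (mul_le_mul_of_nonneg_left (hle z hz) (by positivity))
  have h3 := h2 b bS
  rw [yb, zero_sub, norm_neg, norm_mul, ← hL] at h3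
  have h4 : m ≤ B * m * L * L + ‖deriv y a‖ * L := by
    calc m = ‖(y w - deriv y a * (w - a)) + deriv y a * (w - a)‖ := by rw [sub_add_cancel]
      _ ≤ _ := norm_add_le _ _
      _ ≤ _ := by
        rw [norm_mul]
        exact add_le_add (h2 w hwS) (mul_le_mul_of_nonneg_left (hle w hwS) (norm_nonneg _))
  have h5 : m * 1 ≤ m * (2 * B * L ^ 2) := by nlinarith
  exact le_of_mul_le_mul_left h5 hmpos

/-- Packing bound for a finite separated set in a disc. -/
lemma packing (T : Finset ℂ) (z₀ : ℂ) (R r : ℝ) (hR : 0 ≤ R) (hr : 0 < r)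
    (hT : ∀ z ∈ T, dist z z₀ ≤ R) (hsep : ∀ a ∈ T, ∀ b ∈ T, a ≠ b → r ≤ dist a b) :
    (T.card : ℝ) ≤ (1 + 2 * R / r) ^ 2 := by
  have hdisj : (T : Set ℂ).PairwiseDisjoint (fun z => Metric.ball z (r / 2)) := by
    intro a ha b hb hab
    exact Metric.ball_disjoint_ball (by linarith [hsep a ha b hb hab])
  have hv : volume (⋃ z ∈ T, Metric.ball z (r / 2)) ≤ volume (Metric.ball z₀ (R + r / 2)) := by
    apply measure_mono
    refine Set.iUnion₂_subset fun z hz => Metric.ball_subset_ball' (by linarith [hT z hz])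
  rw [measure_biUnion_finset hdisj (fun _ _ => measurableSet_ball)] at hv
  simp only [Complex.volume_ball, Finset.sum_const, nsmul_eq_mul] at hv
  have hv2 := ENNReal.toReal_mono (by finiteness) hv
  simp only [ENNReal.toReal_mul, ENNReal.toReal_pow, ENNReal.toReal_natCast, ENNReal.coe_toReal,
    NNReal.coe_real_pi, ENNReal.toReal_ofReal (show 0 ≤ r / 2 by positivity),
    ENNReal.toReal_ofReal (show 0 ≤ R + r / 2 by positivity), ← mul_assoc] at hv2
  have hv3 := le_of_mul_le_mul_right hv2 Real.pi_pos
  have : (1 + 2 * R / r) ^ 2 = (R + r / 2) ^ 2 / (r / 2) ^ 2 := by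
    field_simp
    ring
  rw [this, le_div_iff₀ (by positivity)]
  exact hv3

/-- The number of zeros, in the shrinking disc of radius `λ^{-7/12}` around a point,
of a not-identically-zero solution of `y'' = λ² q y` is `O(λ^{5/6}) = o(λ)`. -/
theorem zero_count_near_point_sublinear
    (q : Polynomial ℂ) (hq : q ≠ 0) (z₀ : ℂ) (δ : ℝ) (hδ : 0 < δ) :
    ∃ C : ℝ, 0 < C ∧ ∀ lam : ℝ, 1 ≤ lam → lam ^ (-7 / 12 : ℝ) ≤ δ / 2 →
      ∀ y : ℂ → ℂ, DifferentiableOn ℂ y (Metric.ball z₀ δ) →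
        (∃ z ∈ Metric.ball z₀ δ, y z ≠ 0) →
        (∀ z ∈ Metric.ball z₀ δ, deriv (deriv y) z = (lam : ℂ) ^ 2 * q.eval z * y z) →
        {z : ℂ | dist z z₀ ≤ lam ^ (-7 / 12 : ℝ) ∧ y z = 0}.Finite ∧
        ({z : ℂ | dist z z₀ ≤ lam ^ (-7 / 12 : ℝ) ∧ y z = 0}.ncard : ℝ) ≤
          C * lam ^ (5 / 6 : ℝ) := by
  obtain ⟨M₀, hM₀⟩ := (isCompact_closedBall z₀ δ).exists_bound_of_continuousOn
    (f := fun z => q.eval z) q.continuous.continuousOn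
  set M := max M₀ 1 with hM
  have hM1 : 1 ≤ M := le_max_right _ _
  have hqM : ∀ z ∈ Metric.ball z₀ δ, ‖q.eval z‖ ≤ M := fun z hz =>
    (hM₀ z (Metric.ball_subset_closedBall hz)).trans (le_max_left _ _)
  refine ⟨(1 + 4 * M) ^ 2, by positivity, ?_⟩
  intro lam hlam hsmall y hy hne hode
  have hl0 : 0 < lam := by linarith
  set R := lam ^ (-7 / 12 : ℝ) with hR
  have hR0 : 0 < R := Real.rpow_pos_of_pos hl0 _
  set Z := {z : ℂ | dist z z₀ ≤ R ∧ y z = 0} with hZ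
  have hr0 : 0 < 1 / (2 * M * lam) := by positivity
  have hsep : ∀ a ∈ Z, ∀ b ∈ Z, a ≠ b → 1 / (2 * M * lam) ≤ dist a b := by
    intro a ha b hb hab
    have key := zero_spacing (Metric.ball z₀ δ) Metric.isOpen_ball (convex_ball _ _) y hy hne
      (lam ^ 2 * M) (by positivity) (fun z hz => by
        rw [hode z hz, norm_mul, norm_mul, norm_pow, Complex.norm_real, Real.norm_eq_abs, sq_abs]
        have := hqM z hz
        gcongr) a b
      (Metric.mem_ball.2 (by linarith [ha.1])) (Metric.mem_ball.2 (by linarith [hb.1]))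
      hab ha.2 hb.2
    rw [dist_comm, dist_eq_norm, div_le_iff₀ (by positivity)]
    have h1 : (1 : ℝ) ^ 2 ≤ (‖b - a‖ * (2 * M * lam)) ^ 2 := by
      have : 0 ≤ lam ^ 2 * ‖b - a‖ ^ 2 * M * (4 * M - 2) :=
        mul_nonneg (by positivity) (by linarith)
      nlinarith
    exact le_of_sq_le_sq h1 (by positivity)
  have hexp : lam ^ (5 / 6 : ℝ) = (R * lam) ^ 2 := by
    rw [hR]
    nth_rewrite 3 [← Real.rpow_one lam]
    rw [← Real.rpow_add hl0, ← Real.rpow_natCast, ← Real.rpow_mul hl0.le]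
    norm_num
  have hRl : 1 ≤ R * lam := by
    have h : (1 : ℝ) ^ 2 ≤ (R * lam) ^ 2 := by
      rw [← hexp, one_pow]
      exact Real.one_le_rpow hlam (by norm_num)
    exact le_of_sq_le_sq h (by positivity)
  have hcount : ∀ T : Finset ℂ, (T : Set ℂ) ⊆ Z →
      (T.card : ℝ) ≤ (1 + 4 * M) ^ 2 * lam ^ (5 / 6 : ℝ) := by
    intro T hT
    refine (packing T z₀ R _ hR0.le hr0 (fun z hz => (hT hz).1)
      (fun a ha b hb => hsep a (hT ha) b (hT hb))).trans ?_
    rw [hexp, ← mul_pow]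
    apply pow_le_pow_left₀ (by positivity)
    have : 2 * R / (1 / (2 * M * lam)) = 4 * M * (R * lam) := by
      field_simp
      ring
    rw [this]
    linarith
  have hfin : Z.Finite := by
    by_contra hinf
    obtain ⟨n, hn⟩ := exists_nat_gt ((1 + 4 * M) ^ 2 * lam ^ (5 / 6 : ℝ))
    obtain ⟨T, hT, hcard⟩ := Set.Infinite.exists_subset_card_eq hinf n
    have := hcount T hT
    rw [hcard] at this
    linarith
  refine ⟨hfin, ?_⟩
  rw [Set.ncard_eq_toFinset_card _ hfin]
  exact hcount _ (by simp)
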